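/- Let λ ∈ ℂ with Re λ ≥ 0 and define the sequence (a_n(λ))_{n≥0} by a₀(λ) = 1, a₁(λ) = (λ²+12λ+12)/28, and a_{n+2}(λ) = A_n(λ)a_{n+1}(λ) + B_n(λ)a_n(λ) for n ≥ 0, where A_n(λ) = (12n² + (8λ+56)n + λ² + 20λ + 56)/(8n² + 52n + 72) and B_n(λ) = −(4n² + (4λ+12)n + λ² + 6λ + 8)/(8n² + 52n + 72). Then there exist L ∈ {1/2, 1} and N ∈ ℕ such that a_n(λ) ≠ 0 for all n ≥ N and the sequence a_{n+1}(λ)/a_n(λ) converges to L as n → ∞. -/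

import Mathlib

open Filter

/-- The coefficient `A_n(λ)` of the recurrence relation. -/
noncomputable def An (n : ℕ) (l : ℂ) : ℂ :=
  (12 * (n : ℂ) ^ 2 + (8 * l + 56) * n + l ^ 2 + 20 * l + 56) /
    (8 * (n : ℂ) ^ 2 + 52 * n + 72)

/-- The coefficient `B_n(λ)` of the recurrence relation. -/
noncomputable def Bn (n : ℕ) (l : ℂ) : ℂ :=
  -(4 * (n : ℂ) ^ 2 + (4 * l + 12) * n + l ^ 2 + 6 * l + 8) /
    (8 * (n : ℂ) ^ 2 + 52 * n + 72)

/-- A bounded nonnegative sequence that contracts forward up to a null error tends to zero. -/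
lemma tendsto_zero_of_forward_contraction {r η : ℕ → ℝ} (hη : Tendsto η atTop (nhds 0))
    (h : ∀ᶠ n in atTop, 0 ≤ r n ∧ r n ≤ 1 ∧ r (n + 1) ≤ 3 / 4 * r n + η n) :
    Tendsto r atTop (nhds 0) := by
  rw [Metric.tendsto_atTop]
  intro δ hδ
  obtain ⟨N, hN⟩ := eventually_atTop.1 (h.and (hη.eventually (gt_mem_nhds (by positivity :
    (0 : ℝ) < δ / 8))))
  have key : ∀ k : ℕ, ∀ n ≥ N + k, r n ≤ (3 / 4) ^ k + δ / 2 := by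
    intro k
    induction k with
    | zero =>
      intro n hn
      have := (hN n (by omega)).1.2.1
      simp only [pow_zero]
      linarith
    | succ k ih =>
      intro n hn
      obtain ⟨m, rfl⟩ : ∃ m, n = m + 1 := ⟨n - 1, by omega⟩
      have h1 := ih m (by omega)
      have h2 := hN m (by omega)
      have h3 := h2.1.2.2
      rw [pow_succ]
      linarith
  obtain ⟨k, hk⟩ := exists_pow_lt_of_lt_one (by positivity : (0 : ℝ) < δ / 2)
    (by norm_num : (3 / 4 : ℝ) < 1)
  refine ⟨N + k, fun n hn => ?_⟩
  have h1 := key k n hn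
  have h2 := (hN n (by omega)).1.1
  rw [Real.dist_eq, sub_zero, abs_of_nonneg h2]
  linarith

/-- A bounded nonnegative sequence that contracts backward up to a null error tends to zero. -/
lemma tendsto_zero_of_backward_contraction {r η : ℕ → ℝ} (hη : Tendsto η atTop (nhds 0))
    (h : ∀ᶠ n in atTop, 0 ≤ r n ∧ r n ≤ 1 ∧ r n ≤ 3 / 4 * r (n + 1) + η n) :
    Tendsto r atTop (nhds 0) := by
  rw [Metric.tendsto_atTop]
  intro δ hδ
  obtain ⟨N, hN⟩ := eventually_atTop.1 (h.and (hη.eventually (gt_mem_nhds (by positivity :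
    (0 : ℝ) < δ / 8))))
  have key : ∀ k : ℕ, ∀ n ≥ N, r n ≤ (3 / 4) ^ k + δ / 2 := by
    intro k
    induction k with
    | zero =>
      intro n hn
      have := (hN n (by omega)).1.2.1
      simp only [pow_zero]
      linarith
    | succ k ih =>
      intro n hn
      have h1 := ih (n + 1) (by omega)
      have h2 := hN n hn
      have h3 := h2.1.2.2
      rw [pow_succ]
      linarith
  obtain ⟨k, hk⟩ := exists_pow_lt_of_lt_one (by positivity : (0 : ℝ) < δ / 2)
    (by norm_num : (3 / 4 : ℝ) < 1)
  refine ⟨N, fun n hn => ?_⟩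
  have h1 := key k n hn
  have h2 := (hN n (by omega)).1.1
  rw [Real.dist_eq, sub_zero, abs_of_nonneg h2]
  linarith

/-- Dichotomy for two scalar sequences with growth factors `1` and `1 / 2` and a small
coupling: one of them eventually dominates the other. -/
lemma dominated_dichotomy {u v : ℕ → ℂ} {ε : ℕ → ℝ} (hε : Tendsto ε atTop (nhds 0))
    (hne : ∀ n, u n ≠ 0 ∨ v n ≠ 0)
    (hu : ∀ n, ‖u (n + 1) - u n‖ ≤ ε n * (‖u n‖ + ‖v n‖))
    (hv : ∀ n, ‖v (n + 1) - v n / 2‖ ≤ ε n * (‖u n‖ + ‖v n‖)) :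
    ((∀ᶠ n in atTop, u n ≠ 0) ∧ Tendsto (fun n => v n / u n) atTop (nhds 0)) ∨
    ((∀ᶠ n in atTop, v n ≠ 0) ∧ Tendsto (fun n => u n / v n) atTop (nhds 0)) := by
  have hu_lower : ∀ n, ‖u n‖ - ε n * (‖u n‖ + ‖v n‖) ≤ ‖u (n + 1)‖ := fun n => by
    have h1 := norm_sub_norm_le (u n) (u (n + 1))
    rw [norm_sub_rev] at h1
    linarith [hu n]
  have hv_upper : ∀ n, ‖v (n + 1)‖ ≤ ‖v n‖ / 2 + ε n * (‖u n‖ + ‖v n‖) := fun n => by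
    have h1 := norm_sub_norm_le (v (n + 1)) (v n / 2)
    have h2 : ‖v n / 2‖ = ‖v n‖ / 2 := by simp
    linarith [hv n]
  have hη : Tendsto (fun n => 4 * ε n) atTop (nhds 0) := by simpa using hε.const_mul 4
  obtain ⟨N, hN⟩ := eventually_atTop.1 (hε.eventually (gt_mem_nhds (by norm_num :
    (0 : ℝ) < 1 / 12)))
  have hε0 : ∀ n, 0 ≤ ε n := fun n => by
    have hp : 0 < ‖u n‖ + ‖v n‖ := by
      rcases hne n with h | h
      · have := norm_pos_iff.2 h
        positivity
      · have := norm_pos_iff.2 h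
        positivity
    exact nonneg_of_mul_nonneg_left ((norm_nonneg _).trans (hu n)) hp
  by_cases hcase : ∃ M ≥ N, ‖v M‖ ≤ ‖u M‖
  · left
    obtain ⟨M, hMN, hM⟩ := hcase
    have hle : ∀ n ≥ M, ‖v n‖ ≤ ‖u n‖ := by
      intro n hn
      induction n, hn using Nat.le_induction with
      | base => exact hM
      | succ n hn ih =>
        have h1 := hu_lower n
        have h2 := hv_upper n
        have h3 := hN n (by omega)
        have h4 : ε n * (‖u n‖ + ‖v n‖) ≤ 1 / 12 * (‖u n‖ + ‖v n‖) := by gcongr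
        linarith [norm_nonneg (u n)]
    have hune : ∀ n ≥ M, u n ≠ 0 := by
      intro n hn h0
      have := hle n hn
      rw [h0, norm_zero, norm_le_zero_iff] at this
      exact (hne n).elim (· h0) (· this)
    refine ⟨eventually_atTop.2 ⟨M, hune⟩, ?_⟩
    rw [tendsto_zero_iff_norm_tendsto_zero]
    refine tendsto_zero_of_forward_contraction hη (eventually_atTop.2 ⟨M, fun n hn => ?_⟩)
    have hp := norm_pos_iff.2 (hune n hn)
    have hp' := norm_pos_iff.2 (hune (n + 1) (by omega))
    have hle' := hle n hn
    simp only [norm_div]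
    refine ⟨by positivity, (div_le_one hp).2 hle', ?_⟩
    have h1 := hu_lower n
    have h2 := hv_upper n
    have h3 := hN n (by omega)
    have h4 : ε n * (‖u n‖ + ‖v n‖) ≤ ε n * (2 * ‖u n‖) :=
      mul_le_mul_of_nonneg_left (by linarith) (hε0 n)
    have hr : ‖v n‖ = ‖v n‖ / ‖u n‖ * ‖u n‖ := by field_simp
    have hr0 : 0 ≤ ‖v n‖ / ‖u n‖ := by positivity
    set r := ‖v n‖ / ‖u n‖ with hrdef
    rw [div_le_iff₀ hp']
    have hc : 0 ≤ 3 / 4 * r + 4 * ε n := by linarith [hε0 n]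
    have h5 : (3 / 4 * r + 4 * ε n) * (‖u n‖ * (1 - 2 * ε n)) ≤
        (3 / 4 * r + 4 * ε n) * ‖u (n + 1)‖ := by
      gcongr
      linarith
    have h6 : (r / 2 + 2 * ε n) * ‖u n‖ ≤
        ((3 / 4 * r + 4 * ε n) * (1 - 2 * ε n)) * ‖u n‖ := by
      gcongr
      nlinarith [hε0 n, mul_nonneg hr0 (by linarith : 0 ≤ 1 / 12 - ε n),
        mul_nonneg (hε0 n) (by linarith : 0 ≤ 1 / 12 - ε n)]
    linarith
  · right
    push Not at hcase
    have hvne : ∀ n ≥ N, v n ≠ 0 := fun n hn =>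
      norm_pos_iff.1 ((norm_nonneg _).trans_lt (hcase n hn))
    refine ⟨eventually_atTop.2 ⟨N, hvne⟩, ?_⟩
    rw [tendsto_zero_iff_norm_tendsto_zero]
    refine tendsto_zero_of_backward_contraction hη (eventually_atTop.2 ⟨N, fun n hn => ?_⟩)
    have hp := norm_pos_iff.2 (hvne n hn)
    have hp' := norm_pos_iff.2 (hvne (n + 1) (by omega))
    have hle' := (hcase n hn).le
    simp only [norm_div]
    refine ⟨by positivity, (div_le_one hp).2 hle', ?_⟩
    have h1 := hu_lower n
    have h2 := hv_upper n
    have h3 := hN n hn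
    have h4 : ε n * (‖u n‖ + ‖v n‖) ≤ ε n * (2 * ‖v n‖) :=
      mul_le_mul_of_nonneg_left (by linarith) (hε0 n)
    have hs : ‖u (n + 1)‖ = ‖u (n + 1)‖ / ‖v (n + 1)‖ * ‖v (n + 1)‖ := by field_simp
    have hs0 : 0 ≤ ‖u (n + 1)‖ / ‖v (n + 1)‖ := by positivity
    set s := ‖u (n + 1)‖ / ‖v (n + 1)‖
    rw [div_le_iff₀ hp]
    have h5 : s * ‖v (n + 1)‖ ≤ s * (3 / 4 * ‖v n‖) := by
      gcongr
      have : ε n * (2 * ‖v n‖) ≤ 1 / 12 * (2 * ‖v n‖) := by gcongr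
      linarith
    have h6 := mul_nonneg (hε0 n) hp.le
    linarith

/-- Poincaré's theorem for second-order recurrences with characteristic roots `1 / 2` and `1`
whose last coefficient never vanishes. -/
theorem poincare_half_one {A B a : ℕ → ℂ} (hA : Tendsto A atTop (nhds (3 / 2)))
    (hB : Tendsto B atTop (nhds (-1 / 2))) (hB0 : ∀ n, B n ≠ 0) (h0 : a 0 ≠ 0)
    (hrec : ∀ n, a (n + 2) = A n * a (n + 1) + B n * a n) :
    ∃ L ∈ ({1 / 2, 1} : Set ℂ), ∃ N : ℕ, (∀ n ≥ N, a n ≠ 0) ∧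
      Tendsto (fun n => a (n + 1) / a n) atTop (nhds L) := by
  have hpair : ∀ n, ¬ (a n = 0 ∧ a (n + 1) = 0) := by
    intro n
    induction n with
    | zero => exact fun h => h0 h.1
    | succ n ih =>
      rintro ⟨h1, h2⟩
      have h3 := hrec n
      rw [h1, h2, mul_zero, zero_add, eq_comm, mul_eq_zero] at h3
      exact ih ⟨h3.resolve_left (hB0 n), h1⟩
  set u : ℕ → ℂ := fun n => a (n + 1) - a n / 2 with hu
  set v : ℕ → ℂ := fun n => a (n + 1) - a n with hv
  have ha : ∀ n, a n = 2 * (u n - v n) := fun n => by simp only [hu, hv]; ring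
  have ha' : ∀ n, a (n + 1) = 2 * u n - v n := fun n => by simp only [hu, hv]; ring
  have hε : Tendsto (fun n => 2 * ‖A n - 3 / 2‖ + 2 * ‖B n - -1 / 2‖) atTop (nhds 0) := by
    have h1 := (tendsto_iff_norm_sub_tendsto_zero.1 hA).const_mul 2
    have h2 := (tendsto_iff_norm_sub_tendsto_zero.1 hB).const_mul 2
    simpa using h1.add h2
  have herr : ∀ n, ‖(A n - 3 / 2) * a (n + 1) + (B n - -1 / 2) * a n‖ ≤
      (2 * ‖A n - 3 / 2‖ + 2 * ‖B n - -1 / 2‖) * (‖u n‖ + ‖v n‖) := by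
    intro n
    have h1 : ‖a (n + 1)‖ ≤ 2 * (‖u n‖ + ‖v n‖) := by
      rw [ha']
      refine (norm_sub_le _ _).trans ?_
      rw [norm_mul, Complex.norm_ofNat]
      linarith [norm_nonneg (v n)]
    have h2 : ‖a n‖ ≤ 2 * (‖u n‖ + ‖v n‖) := by
      rw [ha, norm_mul, Complex.norm_ofNat]
      linarith [norm_sub_le (u n) (v n)]
    refine (norm_add_le _ _).trans ?_
    rw [norm_mul, norm_mul]
    have h3 := mul_le_mul_of_nonneg_left h1 (norm_nonneg (A n - 3 / 2))
    have h4 := mul_le_mul_of_nonneg_left h2 (norm_nonneg (B n - -1 / 2))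
    linarith
  have hdich := dominated_dichotomy (u := u) (v := v) hε
    (fun n => by
      by_contra! h
      exact hpair n ⟨by rw [ha, h.1, h.2]; ring, by rw [ha', h.1, h.2]; ring⟩)
    (fun n => by
      convert herr n using 2
      simp only [hu, hrec]
      ring)
    (fun n => by
      convert herr n using 2
      simp only [hv, hrec]
      ring)
  rcases hdich with ⟨hne, ht⟩ | ⟨hne, ht⟩
  · have h1 : ∀ᶠ n in atTop, v n / u n ≠ 1 := ht.eventually_ne (by norm_num)
    obtain ⟨N, hN⟩ := eventually_atTop.1 (hne.and h1)
    refine ⟨1, by simp, N, fun n hn h => ?_, ?_⟩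
    · obtain ⟨h2, h3⟩ := hN n hn
      rw [ha, mul_eq_zero, sub_eq_zero] at h
      exact h3 ((div_eq_one_iff_eq h2).2 (h.resolve_left two_ne_zero).symm)
    · have h2 : Tendsto (fun n => (2 - v n / u n) / (2 * (1 - v n / u n))) atTop
          (nhds ((2 - 0) / (2 * (1 - 0)))) :=
        (ht.const_sub 2).div ((ht.const_sub 1).const_mul 2) (by norm_num)
      norm_num only at h2
      refine h2.congr' (hne.mono fun n hn => ?_)
      beta_reduce
      rw [ha' n, ha n, ← mul_div_mul_right _ _ hn]
      congr 1 <;> field_simp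
  · have h1 : ∀ᶠ n in atTop, u n / v n ≠ 1 := ht.eventually_ne (by norm_num)
    obtain ⟨N, hN⟩ := eventually_atTop.1 (hne.and h1)
    refine ⟨1 / 2, by simp, N, fun n hn h => ?_, ?_⟩
    · obtain ⟨h2, h3⟩ := hN n hn
      rw [ha, mul_eq_zero, sub_eq_zero] at h
      exact h3 ((div_eq_one_iff_eq h2).2 (h.resolve_left two_ne_zero))
    · have h2 : Tendsto (fun n => (2 * (u n / v n) - 1) / (2 * (u n / v n - 1))) atTop
          (nhds ((2 * 0 - 1) / (2 * (0 - 1)))) :=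
        ((ht.const_mul 2).sub_const 1).div ((ht.sub_const 1).const_mul 2) (by norm_num)
      norm_num only at h2
      refine h2.congr' (hne.mono fun n hn => ?_)
      beta_reduce
      rw [ha' n, ha n, ← mul_div_mul_right _ _ hn]
      congr 1 <;> field_simp

/-- The limit of a quotient of quadratic polynomials is the quotient of leading coefficients. -/
lemma tendsto_quadratic_div_quadratic (p q r p' q' r' : ℂ) (hp' : p' ≠ 0) :
    Tendsto (fun n : ℕ => (p * (n : ℂ) ^ 2 + q * n + r) / (p' * (n : ℂ) ^ 2 + q' * n + r'))
      atTop (nhds (p / p')) := by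
  have hi : Tendsto (fun n : ℕ => ((n : ℂ))⁻¹) atTop (nhds 0) :=
    tendsto_inv_atTop_nhds_zero_nat
  have key : ∀ x y z : ℂ, Tendsto (fun n : ℕ => x + y * (n : ℂ)⁻¹ + z * ((n : ℂ)⁻¹) ^ 2)
      atTop (nhds x) := fun x y z => by
    simpa using ((hi.const_mul y).const_add x).add ((hi.pow 2).const_mul z)
  refine ((key p q r).div (key p' q' r') hp').congr' ?_
  filter_upwards [eventually_ne_atTop 0] with n hn
  have hn' : (n : ℂ) ≠ 0 := Nat.cast_ne_zero.2 hn
  simp only [Pi.div_apply]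
  rw [← mul_div_mul_right _ _ (pow_ne_zero 2 hn')]
  congr 1 <;> field_simp

lemma tendsto_An (l : ℂ) : Tendsto (fun n => An n l) atTop (nhds (3 / 2)) := by
  convert tendsto_quadratic_div_quadratic 12 (8 * l + 56) (l ^ 2 + 20 * l + 56) 8 52 72
    (by norm_num) using 2
  · rw [An]
    ring
  · norm_num

lemma tendsto_Bn (l : ℂ) : Tendsto (fun n => Bn n l) atTop (nhds (-1 / 2)) := by
  convert tendsto_quadratic_div_quadratic (-4) (-(4 * l + 12)) (-(l ^ 2 + 6 * l + 8)) 8 52 72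
    (by norm_num) using 2
  · rw [Bn]
    ring
  · norm_num

lemma Bn_ne_zero {l : ℂ} (hl : 0 ≤ l.re) (n : ℕ) : Bn n l ≠ 0 := by
  have hn : (0 : ℝ) ≤ n := n.cast_nonneg
  have hfac : ∀ c : ℝ, 0 < c → 2 * (n : ℂ) + l + c ≠ 0 := fun c hc h => by
    have h' := congrArg Complex.re h
    simp at h'
    linarith
  have hden : 8 * (n : ℂ) ^ 2 + 52 * n + 72 ≠ 0 := by
    norm_cast
  have h2 := hfac 2 (by norm_num)
  have h4 := hfac 4 (by norm_num)
  push_cast at h2 h4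
  refine div_ne_zero (neg_ne_zero.2 ?_) hden
  convert mul_ne_zero h2 h4 using 1
  ring

/-- Poincaré-type asymptotics for the ratios of the Taylor coefficients of the
analytic-at-zero Heun solution. -/
theorem ratio_limit_half_or_one (l : ℂ) (hl : 0 ≤ l.re) (a : ℕ → ℂ)
    (h0 : a 0 = 1) (h1 : a 1 = (l ^ 2 + 12 * l + 12) / 28)
    (hrec : ∀ n : ℕ, a (n + 2) = An n l * a (n + 1) + Bn n l * a n) :
    ∃ L ∈ ({1 / 2, 1} : Set ℂ), ∃ N : ℕ, (∀ n ≥ N, a n ≠ 0) ∧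
      Tendsto (fun n => a (n + 1) / a n) atTop (nhds L) :=
  poincare_half_one (tendsto_An l) (tendsto_Bn l) (Bn_ne_zero hl) (by simp [h0]) hrec
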